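/- For every n > 5, the entropies of the complete graph K_n, the cycle C_n, the wheel graph W_n and the star S_{n−1} satisfy H(K_n) = H(C_n) = log n > H(W_n) > H(S_{n−1}). -/

import Mathlib

open Finset

/-- Number of connected components of the subgraph of `G` induced on the finite
vertex set `C` (this is `0` when `C = ∅`). -/
noncomputable def betti {V : Type*} (G : SimpleGraph V) (C : Finset V) : ℕ :=
  Nat.card ((SimpleGraph.induce (↑C : Set V) G).ConnectedComponent)

/-- The Shapley influence value
`s(v) = Σ_{C ⊆ V∖{v}} (|C|!·(n−|C|−1)!/n!)·|β(C∪{v}) − β(C)|`. -/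
noncomputable def shapley {V : Type*} [Fintype V] [DecidableEq V]
    (G : SimpleGraph V) (v : V) : ℝ :=
  ∑ C ∈ (Finset.univ.erase v).powerset,
    ((C.card.factorial : ℝ) * ((Fintype.card V - C.card - 1).factorial : ℝ)
        / ((Fintype.card V).factorial : ℝ)) *
      |((betti G (insert v C) : ℝ)) - ((betti G C : ℝ))|

/-- Normalized influence score `μ(v) = s(v) / Σ_u s(u)`. -/
noncomputable def influence {V : Type*} [Fintype V] [DecidableEq V]
    (G : SimpleGraph V) (v : V) : ℝ :=
  shapley G v / ∑ u : V, shapley G u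

/-- Entropy `H(G) = −Σ_v μ(v)·log μ(v)`. -/
noncomputable def graphEntropy {V : Type*} [Fintype V] [DecidableEq V]
    (G : SimpleGraph V) : ℝ :=
  -∑ v : V, influence G v * Real.log (influence G v)

/-- The cycle graph on `Fin n`: `i` adjacent to `j` iff they differ by `1` mod `n`. -/
def cycleGraph (n : ℕ) : SimpleGraph (Fin n) :=
  SimpleGraph.fromRel (fun i j => (i.val + 1) % n = j.val)

/-- The wheel graph with `m` periphery vertices (a cycle on `Fin m`) and a
center `none` adjacent to every periphery vertex; it has `m + 1` vertices. -/
def wheelGraph (m : ℕ) : SimpleGraph (Option (Fin m)) :=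
  SimpleGraph.fromRel (fun a b =>
    a = none ∨ ∃ i j, a = some i ∧ b = some j ∧ (i.val + 1) % m = j.val)

/-- The star graph with center `none` adjacent to `m` leaves, no edges among leaves. -/
def starGraph (m : ℕ) : SimpleGraph (Option (Fin m)) :=
  SimpleGraph.fromRel (fun a _ => a = none)


/-- The average of `f` over the random set of vertices preceding `v` in a uniform ordering. -/
noncomputable def shapleyMean {V : Type*} [Fintype V] [DecidableEq V]
    (v : V) (f : Finset V → ℝ) : ℝ :=
  ∑ C ∈ (Finset.univ.erase v).powerset,
    ((C.card.factorial : ℝ) * ((Fintype.card V - C.card - 1).factorial : ℝ)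
        / ((Fintype.card V).factorial : ℝ)) * f C

/-- The indicator of the sets that contain `A` and avoid `B`. -/
noncomputable def sepInd {V : Type*} [DecidableEq V] (A B C : Finset V) : ℝ :=
  if A ⊆ C ∧ Disjoint B C then 1 else 0

section ShapleyMean

variable {V : Type*} [Fintype V] [DecidableEq V]

lemma shapley_eq_shapleyMean (G : SimpleGraph V) (v : V) (f : Finset V → ℝ)
    (h : ∀ C, v ∉ C → |(betti G (insert v C) : ℝ) - betti G C| = f C) :
    shapley G v = shapleyMean v f := by
  refine sum_congr rfl fun C hC => ?_
  rw [h C fun hv => by simpa using mem_powerset.1 hC hv]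

lemma shapleyMean_add (v : V) (f g : Finset V → ℝ) :
    shapleyMean v (fun C => f C + g C) = shapleyMean v f + shapleyMean v g := by
  simp only [shapleyMean, mul_add, sum_add_distrib]

lemma shapleyMean_sub (v : V) (f g : Finset V → ℝ) :
    shapleyMean v (fun C => f C - g C) = shapleyMean v f - shapleyMean v g := by
  simp only [shapleyMean, mul_sub, sum_sub_distrib]

lemma shapleyMean_const_mul (v : V) (a : ℝ) (f : Finset V → ℝ) :
    shapleyMean v (fun C => a * f C) = a * shapleyMean v f := by
  simp only [shapleyMean, mul_sum]
  exact sum_congr rfl fun _ _ => by ring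

lemma shapleyMean_sum {ι : Type*} (s : Finset ι) (v : V) (f : ι → Finset V → ℝ) :
    shapleyMean v (fun C => ∑ i ∈ s, f i C) = ∑ i ∈ s, shapleyMean v (f i) := by
  simp only [shapleyMean, mul_sum]
  exact sum_comm

lemma shapleyMean_sepInd (v : V) (A B : Finset V) (hA : v ∉ A) (hB : v ∉ B)
    (hAB : Disjoint A B) :
    shapleyMean v (sepInd A B) =
      (A.card.factorial : ℝ) * B.card.factorial / (A.card + B.card + 1).factorial := by
  obtain ⟨r, hr⟩ : ∃ r, r = ((univ.erase v) \ (A ∪ B)).card := ⟨_, rfl⟩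
  induction r generalizing A B with
  | zero =>
    have hU : univ.erase v = A ∪ B := by
      apply subset_antisymm
      · exact sdiff_eq_empty_iff_subset.1 (card_eq_zero.1 hr.symm)
      · intro x hx
        simp only [mem_erase, mem_univ, and_true]
        rintro rfl
        simp_all
    have hc : Fintype.card V = A.card + B.card + 1 := by
      have := card_erase_add_one (mem_univ v)
      rw [hU, card_union_of_disjoint hAB, card_univ] at this
      exact this.symm
    rw [shapleyMean, hU, sum_eq_single A]
    · have : sepInd A B A = 1 := by simp [sepInd, hAB.symm]
      rw [this, hc, show A.card + B.card + 1 - A.card - 1 = B.card by omega, mul_one]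
    · intro C hC hCA
      have : ¬ (A ⊆ C ∧ Disjoint B C) := by
        rintro ⟨h1, h2⟩
        refine hCA (subset_antisymm (fun x hx => ?_) h1)
        rcases mem_union.1 (mem_powerset.1 hC hx) with h | h
        · exact h
        · exact absurd hx (disjoint_left.1 h2 h)
      simp [sepInd, this]
    · exact fun h => absurd (mem_powerset.2 subset_union_left) h
  | succ r ih =>
    obtain ⟨x, hx⟩ : ((univ.erase v) \ (A ∪ B)).Nonempty := card_pos.1 (by omega)
    have hx' := hx
    simp only [mem_sdiff, mem_erase, mem_univ, and_true, mem_union, not_or] at hx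
    obtain ⟨hxv, hxA, hxB⟩ := hx
    have hr1 : r = ((univ.erase v) \ (insert x A ∪ B)).card := by
      rw [insert_union, sdiff_insert, card_erase_of_mem hx']; omega
    have hr2 : r = ((univ.erase v) \ (A ∪ insert x B)).card := by
      rw [union_insert, sdiff_insert, card_erase_of_mem hx']; omega
    have h1 := ih (insert x A) B (by simp [hA, hxv.symm]) hB (by simp [hAB, hxB]) hr1
    have h2 := ih A (insert x B) hA (by simp [hB, hxv.symm]) (by simp [hAB, hxA]) hr2
    have hsplit : sepInd A B = fun C => sepInd (insert x A) B C + sepInd A (insert x B) C := by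
      funext C
      by_cases hxC : x ∈ C <;> simp [sepInd, insert_subset_iff, hxC]
    rw [hsplit, shapleyMean_add, h1, h2, card_insert_of_notMem hxA, card_insert_of_notMem hxB,
      show A.card + 1 + B.card + 1 = (A.card + B.card + 1) + 1 by ring,
      show A.card + (B.card + 1) + 1 = (A.card + B.card + 1) + 1 by ring]
    simp only [Nat.factorial_succ]
    push_cast
    field_simp
    ring

lemma shapleyMean_const (v : V) (a : ℝ) : shapleyMean v (fun _ => a) = a := by
  have h := shapleyMean_sepInd v ∅ ∅ (by simp) (by simp) (by simp)
  have h' := shapleyMean_const_mul v a (sepInd ∅ ∅)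
  simpa [h, sepInd] using h'

end ShapleyMean

section Betti

variable {V W : Type*}

lemma betti_map {G : SimpleGraph V} {H : SimpleGraph W} (f : G ↪g H) (C : Finset V) :
    betti H (C.map f.toEmbedding) = betti G C := by
  have e : SimpleGraph.induce (↑C : Set V) G ≃g
      SimpleGraph.induce (↑(C.map f.toEmbedding) : Set W) H :=
    { toEquiv := (Equiv.Set.image f C f.injective).trans (Equiv.setCongr (by simp))
      map_rel_iff' := by
        intro a b
        exact f.map_adj_iff }
  exact (Nat.card_congr e.connectedComponentEquiv).symm

lemma betti_empty (G : SimpleGraph V) : betti G ∅ = 0 := by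
  rw [betti, Nat.card_eq_zero]
  left
  constructor
  intro c
  induction c using SimpleGraph.ConnectedComponent.ind with
  | _ v => simpa using v.2

lemma betti_eq_one_of_dominating {G : SimpleGraph V} {C : Finset V} {c : V} (hc : c ∈ C)
    (h : ∀ x ∈ C, x ≠ c → G.Adj c x) : betti G C = 1 := by
  rw [betti, Nat.card_eq_one_iff_exists]
  refine ⟨SimpleGraph.connectedComponentMk _ ⟨c, by simpa using hc⟩, fun d => ?_⟩
  induction d using SimpleGraph.ConnectedComponent.ind with
  | _ v =>
    rw [SimpleGraph.ConnectedComponent.eq]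
    by_cases hv : (v : V) = c
    · have : v = ⟨c, by simpa using hc⟩ := Subtype.ext hv
      rw [this]
    · exact (SimpleGraph.Adj.reachable (by simpa using h v v.2 hv)).symm

lemma betti_eq_card_of_indep {G : SimpleGraph V} {C : Finset V}
    (h : ∀ x ∈ C, ∀ y ∈ C, ¬ G.Adj x y) : betti G C = C.card := by
  have hbot : SimpleGraph.induce (↑C : Set V) G = ⊥ := by
    ext x y
    simpa using h x x.2 y y.2
  rw [betti, hbot, ← Nat.card_congr (Equiv.ofBijective
    (SimpleGraph.connectedComponentMk (⊥ : SimpleGraph (↑C : Set V))) ⟨?_, ?_⟩)]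
  · simp
  · intro x y hxy
    simpa using SimpleGraph.ConnectedComponent.exact hxy
  · intro c
    exact c.exists_rep

end Betti

section Cycle

variable {V : Type*} {σ : Equiv.Perm V} {G : SimpleGraph V}

lemma betti_eq_card_ends (hσ : ∀ i j, ∃ k : ℕ, σ^[k] i = j)
    (hG : ∀ i j, G.Adj i j ↔ i ≠ j ∧ (σ i = j ∨ σ j = i)) {C : Finset V}
    (hC : ∃ x, x ∉ C) : betti G C = Nat.card {i : V // i ∈ C ∧ σ i ∉ C} := by
  classical
  have hex : ∀ i, ∃ k : ℕ, σ^[k + 1] i ∉ C := by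
    intro i
    obtain ⟨x, hx⟩ := hC
    obtain ⟨k, hk⟩ := hσ (σ i) x
    exact ⟨k, by rwa [Function.iterate_succ_apply, hk]⟩
  let d : V → ℕ := fun i => Nat.find (hex i)
  have hd0 : ∀ i, σ i ∉ C → d i = 0 := fun i hi => (Nat.find_eq_zero (hex i)).2 (by simpa using hi)
  have hd1 : ∀ i, σ i ∈ C → d i = d (σ i) + 1 := fun i hi =>
    Nat.find_comp_succ (hex i) (hex (σ i)) (by simpa using hi)
  let f : V → V := fun i => σ^[d i] i
  have hf0 : ∀ i, σ i ∉ C → f i = i := fun i hi => by simp [f, hd0 i hi]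
  have hf1 : ∀ i, σ i ∈ C → f i = f (σ i) := fun i hi => by
    simp only [f, hd1 i hi, Function.iterate_succ_apply]
  have hreach : ∀ x y : (↑C : Set V), (SimpleGraph.induce (↑C : Set V) G).Reachable x y →
      f x = f y := by
    rintro x y ⟨p⟩
    induction p with
    | nil => rfl
    | @cons u v w huv _ ih =>
      rw [← ih]
      have hadj : G.Adj u v := huv
      rcases ((hG _ _).1 hadj).2 with h | h
      · rw [hf1 u (by rw [h]; exact v.2), h]
      · rw [hf1 v (by rw [h]; exact u.2), h]
  have hend : ∀ n, ∀ x : (↑C : Set V), d x = n → ∃ y : {i : V // i ∈ C ∧ σ i ∉ C},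
      (SimpleGraph.induce (↑C : Set V) G).Reachable ⟨y, y.2.1⟩ x := by
    intro n
    induction n with
    | zero =>
      intro x hx
      have hx' : σ x ∉ C := fun h => by have := hd1 x h; omega
      exact ⟨⟨x, x.2, hx'⟩, SimpleGraph.Reachable.refl _⟩
    | succ n ih =>
      intro x hx
      have hx' : σ x ∈ C := by
        by_contra h
        have := hd0 x h
        omega
      obtain ⟨y, hy⟩ := ih ⟨σ x, hx'⟩ (by have := hd1 x hx'; simp only; omega)
      refine ⟨y, hy.trans ?_⟩
      by_cases hxx : σ x = x
      · have : (⟨σ x, hx'⟩ : (↑C : Set V)) = x := Subtype.ext hxx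
        rw [this]
      · exact SimpleGraph.Adj.reachable ((hG _ _).2 ⟨hxx, Or.inr rfl⟩)
  rw [betti, eq_comm]
  refine Nat.card_congr (Equiv.ofBijective (fun y : {i : V // i ∈ C ∧ σ i ∉ C} =>
    (SimpleGraph.induce (↑C : Set V) G).connectedComponentMk ⟨y, y.2.1⟩) ⟨?_, ?_⟩)
  · intro x y hxy
    have := hreach _ _ (SimpleGraph.ConnectedComponent.exact hxy)
    simp only [hf0 _ x.2.2, hf0 _ y.2.2] at this
    exact Subtype.ext this
  · intro c
    induction c using SimpleGraph.ConnectedComponent.ind with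
    | _ x =>
      obtain ⟨y, hy⟩ := hend _ x rfl
      exact ⟨y, SimpleGraph.ConnectedComponent.sound hy⟩

lemma betti_cycle_univ [Fintype V] [Nonempty V] (hσ : ∀ i j, ∃ k : ℕ, σ^[k] i = j)
    (hG : ∀ i j, G.Adj i j ↔ i ≠ j ∧ (σ i = j ∨ σ j = i)) : betti G univ = 1 := by
  have hstep : ∀ (k : ℕ) (i : V), (SimpleGraph.induce (↑(univ : Finset V) : Set V) G).Reachable
      ⟨i, by simp⟩ ⟨σ^[k] i, by simp⟩ := by
    intro k
    induction k with
    | zero => exact fun i => SimpleGraph.Reachable.refl _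
    | succ k ih =>
      intro i
      refine SimpleGraph.Reachable.trans ?_ (ih (σ i))
      by_cases hi : i = σ i
      · simp only [← hi]
        exact SimpleGraph.Reachable.refl _
      · exact SimpleGraph.Adj.reachable ((hG _ _).2 ⟨hi, Or.inl rfl⟩)
  rw [betti, Nat.card_eq_one_iff_exists]
  let i := Classical.arbitrary V
  refine ⟨SimpleGraph.connectedComponentMk _ ⟨i, by simp⟩, fun c => ?_⟩
  induction c using SimpleGraph.ConnectedComponent.ind with
  | _ x =>
    obtain ⟨k, hk⟩ := hσ i x
    have := hstep k i
    simp only [hk] at this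
    exact SimpleGraph.ConnectedComponent.sound this.symm

lemma betti_cycle_eq_sum [Fintype V] [DecidableEq V] [Nonempty V]
    (hσ : ∀ i j, ∃ k : ℕ, σ^[k] i = j)
    (hG : ∀ i j, G.Adj i j ↔ i ≠ j ∧ (σ i = j ∨ σ j = i)) (C : Finset V) :
    (betti G C : ℝ) = ∑ i, sepInd {i} {σ i} C + sepInd univ ∅ C := by
  by_cases hC : C = univ
  · subst hC
    rw [betti_cycle_univ hσ hG]
    simp [sepInd]
  · have hx : ∃ x, x ∉ C := by simpa [eq_univ_iff_forall] using hC
    rw [betti_eq_card_ends hσ hG hx]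
    have h0 : sepInd univ ∅ C = 0 := by simp [sepInd, univ_subset_iff, hC]
    have h1 : ∀ i, sepInd {i} {σ i} C = if i ∈ C ∧ σ i ∉ C then 1 else 0 := by
      intro i
      simp [sepInd]
    simp only [h0, h1, add_zero, Nat.card_eq_fintype_card, Fintype.card_subtype, sum_boole]

lemma abs_betti_cycle_insert_sub [Fintype V] [DecidableEq V]
    (hσ : ∀ i j, ∃ k : ℕ, σ^[k] i = j)
    (hG : ∀ i j, G.Adj i j ↔ i ≠ j ∧ (σ i = j ∨ σ j = i)) (h1 : ∀ i, σ i ≠ i)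
    {v : V} {C : Finset V} (hv : v ∉ C) :
    |(betti G (insert v C) : ℝ) - betti G C| =
      sepInd ∅ {σ v, σ.symm v} C + sepInd {σ v, σ.symm v} ∅ C - sepInd (univ.erase v) ∅ C := by
  have : Nonempty V := ⟨v⟩
  rw [betti_cycle_eq_sum hσ hG, betti_cycle_eq_sum hσ hG]
  have hpt : ∀ i, sepInd {i} {σ i} (insert v C) - sepInd {i} {σ i} C =
      (if i = v then (if σ v ∈ C then 0 else 1) else 0) -
        (if i = σ.symm v then (if σ.symm v ∈ C then 1 else 0) else 0 : ℝ) := by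
    intro i
    by_cases hi : i = v
    · subst hi
      have h2 : i ≠ σ.symm i := fun h => h1 i ((Equiv.eq_symm_apply σ).1 h)
      simp [sepInd, hv, h2, h1]
    · by_cases hi' : i = σ.symm v
      · have : σ i = v := by rw [hi']; simp
        simp [sepInd, hi, this, hv, ← hi']
      · have : σ i ≠ v := fun h => hi' (by rw [← h]; simp)
        simp [sepInd, hi, hi', this]
  have hsum := sum_congr rfl fun i (_ : i ∈ univ) => hpt i
  rw [sum_sub_distrib, sum_sub_distrib, sum_ite_eq' univ v, sum_ite_eq' univ (σ.symm v)] at hsum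
  simp only [mem_univ, if_true] at hsum
  have hCu : sepInd univ ∅ C = 0 := by
    have : ¬ univ ⊆ C := fun h => hv (h (mem_univ v))
    simp [sepInd, this]
  have hins : sepInd univ ∅ (insert v C) = sepInd (univ.erase v) ∅ C := by
    have : univ ⊆ insert v C ↔ univ.erase v ⊆ C := subset_insert_iff
    simp [sepInd, this]
  rw [hCu, hins, show ∀ a b c d : ℝ, a + b - (c + d) = (a - c) + (b - d) from fun _ _ _ _ => by ring,
    hsum]
  have key : (σ v ∈ C ∧ σ.symm v ∈ C) ∨ sepInd (univ.erase v) ∅ C = 0 := by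
    by_cases h : univ.erase v ⊆ C
    · refine Or.inl ⟨h (by simp [h1]), h ?_⟩
      have : σ.symm v ≠ v := fun h => h1 v ((Equiv.symm_apply_eq σ).1 h).symm
      simp [this]
    · right; simp [sepInd, h]
  have h01 : sepInd (univ.erase v) ∅ C = 0 ∨ sepInd (univ.erase v) ∅ C = 1 := by
    unfold sepInd
    split_ifs <;> simp
  generalize sepInd (univ.erase v) ∅ C = t at *
  by_cases hp : σ v ∈ C <;> by_cases hq : σ.symm v ∈ C <;>
    simp only [hp, hq, sepInd, insert_subset_iff, singleton_subset_iff, disjoint_insert_left,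
      disjoint_singleton_left] at * <;> rcases h01 with rfl | rfl <;> simp_all

end Cycle

section Dominating

variable {V : Type*} {G : SimpleGraph V}

lemma betti_pos {C : Finset V} (hC : C.Nonempty) : 0 < betti G C := by
  obtain ⟨x, hx⟩ := hC
  have : Finite (↑C : Set V) := C.finite_toSet
  have : Nonempty ((SimpleGraph.induce (↑C : Set V) G).ConnectedComponent) :=
    ⟨SimpleGraph.connectedComponentMk _ ⟨x, hx⟩⟩
  exact Nat.card_pos

variable [Fintype V] [DecidableEq V]

lemma shapley_of_dominating {v : V} (h : ∀ x, x ≠ v → G.Adj v x) (f : Finset V → ℝ)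
    (hf : ∀ C, v ∉ C → (betti G C : ℝ) = f C) :
    shapley G v = shapleyMean v f - 1 + 2 / Fintype.card V := by
  have hmean := shapleyMean_sepInd v ∅ (univ.erase v) (by simp) (by simp) (by simp)
  obtain ⟨m, hm⟩ : ∃ m, Fintype.card V = m + 1 :=
    ⟨_, (Nat.succ_pred_eq_of_pos (Fintype.card_pos_iff.2 ⟨v⟩)).symm⟩
  rw [card_erase_of_mem (mem_univ v), card_univ, hm, card_empty, add_tsub_cancel_right, zero_add,
    Nat.factorial_succ] at hmean
  rw [shapley_eq_shapleyMean G v (fun C => f C - 1 + 2 * sepInd ∅ (univ.erase v) C),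
    shapleyMean_add, shapleyMean_sub, shapleyMean_const, shapleyMean_const_mul, hmean, hm]
  · push_cast
    field_simp
    simp
  · intro C hv
    rw [betti_eq_one_of_dominating (mem_insert_self v C) fun x _ hx => h x hx, ← hf C hv]
    rcases C.eq_empty_or_nonempty with rfl | hC
    · simp [betti_empty, sepInd]
      norm_num
    · have hpos : (1 : ℝ) ≤ betti G C := by exact_mod_cast betti_pos hC
      obtain ⟨x, hx⟩ := hC
      have : ¬ Disjoint (univ.erase v) C := fun hd =>
        disjoint_left.1 hd (mem_erase.2 ⟨fun h => hv (h ▸ hx), mem_univ x⟩) hx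
      simp only [sepInd, this, and_false, if_false]
      rw [abs_of_nonpos] <;> push_cast <;> linarith

lemma shapley_top (v : V) : shapley (⊤ : SimpleGraph V) v = 1 / Fintype.card V := by
  have hmean := shapleyMean_sepInd v ∅ (univ.erase v) (by simp) (by simp) (by simp)
  obtain ⟨m, hm⟩ : ∃ m, Fintype.card V = m + 1 :=
    ⟨_, (Nat.succ_pred_eq_of_pos (Fintype.card_pos_iff.2 ⟨v⟩)).symm⟩
  rw [card_erase_of_mem (mem_univ v), card_univ, hm, card_empty, add_tsub_cancel_right, zero_add,
    Nat.factorial_succ] at hmean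
  rw [shapley_of_dominating (by simp [eq_comm]) fun C => 1 - sepInd ∅ (univ.erase v) C,
    shapleyMean_sub, shapleyMean_const, hmean, hm]
  · push_cast
    field_simp
    simp
    norm_num
  · intro C hv
    rcases C.eq_empty_or_nonempty with rfl | ⟨x, hx⟩
    · simp [betti_empty, sepInd]
    · have : ¬ Disjoint (univ.erase v) C := fun hd =>
        disjoint_left.1 hd (mem_erase.2 ⟨fun h => hv (h ▸ hx), mem_univ x⟩) hx
      rw [betti_eq_one_of_dominating hx fun y _ hy => by simpa using hy.symm]
      simp [sepInd, this]

lemma shapley_cycle {σ : Equiv.Perm V} (hσ : ∀ i j, ∃ k : ℕ, σ^[k] i = j)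
    (hG : ∀ i j, G.Adj i j ↔ i ≠ j ∧ (σ i = j ∨ σ j = i)) (h1 : ∀ i, σ i ≠ i)
    (h2 : ∀ i, σ i ≠ σ.symm i) (v : V) : shapley G v = 2 / 3 - 1 / Fintype.card V := by
  have hs : v ≠ σ.symm v := fun h => h1 v ((Equiv.eq_symm_apply σ).1 h)
  obtain ⟨m, hm⟩ : ∃ m, Fintype.card V = m + 1 :=
    ⟨_, (Nat.succ_pred_eq_of_pos (Fintype.card_pos_iff.2 ⟨v⟩)).symm⟩
  have hv : v ∉ ({σ v, σ.symm v} : Finset V) := by simp [hs, (h1 v).symm]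
  rw [shapley_eq_shapleyMean G v _ fun C hC => abs_betti_cycle_insert_sub hσ hG h1 hC,
    shapleyMean_sub, shapleyMean_add, shapleyMean_sepInd v _ _ (by simp) hv (by simp),
    shapleyMean_sepInd v _ _ hv (by simp) (by simp),
    shapleyMean_sepInd v _ _ (by simp) (by simp) (by simp), card_pair (h2 v),
    card_erase_of_mem (mem_univ v), card_univ, hm, card_empty, add_tsub_cancel_right, add_zero,
    Nat.factorial_succ m]
  push_cast
  simp [Nat.factorial]
  field_simp
  ring

end Dominating

section Cone

open Function.Embedding (some)

variable {V : Type*} [DecidableEq V]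

lemma exists_eq_map_some {C : Finset (Option V)} (hC : none ∉ C) : ∃ D : Finset V, C = D.map some :=
  ⟨eraseNone C, by rw [map_some_eraseNone, erase_eq_of_notMem hC]⟩

lemma sepInd_map_some (A B D : Finset V) :
    sepInd (A.map some) (B.map some) (D.map some) = sepInd A B D := by
  simp [sepInd]

lemma sepInd_insert_none_of_mem {A B C : Finset (Option V)} (hC : none ∈ C) :
    sepInd A (insert none B) C = 0 := by
  simp [sepInd, hC]

lemma sepInd_insert_none_of_notMem {A B C : Finset (Option V)} (hC : none ∉ C) :
    sepInd A (insert none B) C = sepInd A B C := by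
  simp [sepInd, hC]

lemma shapley_cone_cycle_none [Fintype V] [Nonempty V] {σ : Equiv.Perm V} {G : SimpleGraph V}
    {W : SimpleGraph (Option V)} (hσ : ∀ i j, ∃ k : ℕ, σ^[k] i = j)
    (hG : ∀ i j, G.Adj i j ↔ i ≠ j ∧ (σ i = j ∨ σ j = i)) (h1 : ∀ i, σ i ≠ i)
    (f : G ↪g W) (hf : f.toEmbedding = Function.Embedding.some) (hW : ∀ i : V, W.Adj none (Option.some i)) :
    shapley W none = Fintype.card V / 6 - 1 + 3 / (Fintype.card V + 1) := by
  rw [shapley_of_dominating (fun x hx => by cases x; exacts [absurd rfl hx, hW _])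
    (fun C => ∑ i, sepInd (({i} : Finset V).map some) (({σ i} : Finset V).map some) C
      + sepInd (univ.map some) ((∅ : Finset V).map some) C), shapleyMean_add, shapleyMean_sum]
  · have hi : ∀ i, shapleyMean (V := Option V) none
        (sepInd (({i} : Finset V).map some) (({σ i} : Finset V).map some)) = 1 / 6 := by
      intro i
      rw [shapleyMean_sepInd _ _ _ (by simp) (by simp) (by simp [(h1 i).symm])]
      simp [Nat.factorial]
    rw [sum_congr rfl fun i _ => hi i, shapleyMean_sepInd _ _ _ (by simp) (by simp) (by simp)]
    simp only [sum_const, card_map, card_univ, card_empty, add_zero, Fintype.card_option,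
      Nat.factorial_succ, nsmul_eq_mul]
    push_cast
    field_simp
    simp
    ring
  · intro C hC
    obtain ⟨D, rfl⟩ := exists_eq_map_some hC
    simp only [sepInd_map_some]
    rw [← hf, betti_map, betti_cycle_eq_sum hσ hG]

lemma shapley_cone_cycle_some [Fintype V] {σ : Equiv.Perm V} {G : SimpleGraph V}
    {W : SimpleGraph (Option V)} (hσ : ∀ i j, ∃ k : ℕ, σ^[k] i = j)
    (hG : ∀ i j, G.Adj i j ↔ i ≠ j ∧ (σ i = j ∨ σ j = i)) (h1 : ∀ i, σ i ≠ i)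
    (h2 : ∀ i, σ i ≠ σ.symm i)
    (f : G ↪g W) (hf : f.toEmbedding = Function.Embedding.some) (hW : ∀ i : V, W.Adj none (Option.some i)) (v : V) :
    shapley W (Option.some v) =
      1 / 3 - 1 / (Fintype.card V * (Fintype.card V + 1)) := by
  have hs : v ≠ σ.symm v := fun h => h1 v ((Equiv.eq_symm_apply σ).1 h)
  have hv : v ∉ ({σ v, σ.symm v} : Finset V) := by simp [hs, (h1 v).symm]
  obtain ⟨m, hm⟩ : ∃ m, Fintype.card V = m + 1 :=
    ⟨_, (Nat.succ_pred_eq_of_pos (Fintype.card_pos_iff.2 ⟨v⟩)).symm⟩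
  rw [shapley_eq_shapleyMean W (Option.some v) (fun C =>
      sepInd ((∅ : Finset V).map some) (insert none (({σ v, σ.symm v} : Finset V).map some)) C
      + sepInd (({σ v, σ.symm v} : Finset V).map some) (insert none ((∅ : Finset V).map some)) C
      - sepInd ((univ.erase v).map some) (insert none ((∅ : Finset V).map some)) C)]
  · have hmem : ∀ A : Finset V, v ∉ A → Option.some v ∉ A.map some := fun A hA => by simpa using hA
    have hins : ∀ A : Finset V, v ∉ A → Option.some v ∉ insert none (A.map some) := fun A hA => by
      simpa using hA
    rw [shapleyMean_sub, shapleyMean_add,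
      shapleyMean_sepInd _ _ _ (hmem _ (by simp)) (hins _ hv) (by simp),
      shapleyMean_sepInd _ _ _ (hmem _ hv) (hins _ (by simp)) (by simp),
      shapleyMean_sepInd _ _ _ (hmem _ (by simp)) (hins _ (by simp)) (by simp)]
    simp only [card_insert_of_notMem (show none ∉ (_ : Finset V).map some by simp), card_map,
      card_pair (h2 v), card_erase_of_mem (mem_univ v), card_univ, hm, card_empty,
      add_tsub_cancel_right, zero_add, Nat.factorial_succ]
    push_cast
    simp [Nat.factorial]
    field_simp
    ring
  · intro C hvC
    by_cases hC : none ∈ C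
    · have hdom : ∀ x, x ≠ none → W.Adj none x := fun x hx => by
        cases x; exacts [absurd rfl hx, hW _]
      rw [betti_eq_one_of_dominating hC fun x _ hx => hdom x hx,
        betti_eq_one_of_dominating (mem_insert_of_mem hC) fun x _ hx => hdom x hx]
      simp only [sepInd_insert_none_of_mem hC]
      simp
    · simp only [sepInd_insert_none_of_notMem hC]
      obtain ⟨D, rfl⟩ := exists_eq_map_some hC
      have hvD : v ∉ D := by simpa using hvC
      simp only [sepInd_map_some]
      rw [← abs_betti_cycle_insert_sub hσ hG h1 hvD, ← betti_map f D, ← betti_map f (insert v D),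
        map_insert, hf]
      rfl

end Cone

section Star

variable {m : ℕ}

lemma starGraph_adj_none (i : Fin m) : (starGraph m).Adj none (some i) := by
  simp [starGraph]

lemma starGraph_not_adj_some (i j : Fin m) : ¬ (starGraph m).Adj (some i) (some j) := by
  simp [starGraph]

lemma betti_starGraph {C : Finset (Option (Fin m))} (hC : none ∉ C) :
    betti (starGraph m) C = C.card := by
  refine betti_eq_card_of_indep fun x hx y hy => ?_
  cases x with
  | none => exact absurd hx hC
  | some i =>
    cases y with
    | none => exact absurd hy hC
    | some j => exact starGraph_not_adj_some i j

lemma shapley_starGraph_none :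
    shapley (starGraph m) none = m / 2 - 1 + 2 / (m + 1) := by
  rw [shapley_of_dominating (fun x hx => by cases x; exacts [absurd rfl hx, starGraph_adj_none _])
    (fun C => ∑ i : Fin m, sepInd {some i} ∅ C), shapleyMean_sum]
  · have hi : ∀ i : Fin m, shapleyMean none (sepInd {some i} ∅) = 1 / 2 := by
      intro i
      rw [shapleyMean_sepInd _ _ _ (by simp) (by simp) (by simp)]
      simp
    rw [sum_congr rfl fun i _ => hi i]
    simp
    ring
  · intro C hC
    obtain ⟨D, rfl⟩ := exists_eq_map_some hC
    rw [betti_starGraph hC]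
    simp [sepInd]

lemma shapley_starGraph_some (i : Fin m) : shapley (starGraph m) (some i) = 1 / 2 := by
  rw [shapley_eq_shapleyMean _ _ (sepInd ∅ {none}),
    shapleyMean_sepInd _ _ _ (by simp) (by simp) (by simp)]
  · simp
  · intro C hiC
    by_cases hC : none ∈ C
    · have hdom : ∀ x, x ≠ none → (starGraph m).Adj none x := fun x hx => by
        cases x; exacts [absurd rfl hx, starGraph_adj_none _]
      rw [betti_eq_one_of_dominating hC fun x _ hx => hdom x hx,
        betti_eq_one_of_dominating (mem_insert_of_mem hC) fun x _ hx => hdom x hx]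
      simp [sepInd, hC]
    · rw [betti_starGraph hC, betti_starGraph (by simp [hC]), card_insert_of_notMem hiC]
      simp [sepInd, hC]

end Star

section Rotation

variable {m : ℕ}

lemma finRotate_eq_iff (i j : Fin m) : finRotate m i = j ↔ (i.val + 1) % m = j.val := by
  have := i.neZero
  rw [Fin.ext_iff, finRotate_apply, Fin.val_add]
  simp

lemma finRotate_ne_self (hm : 2 ≤ m) (i : Fin m) : finRotate m i ≠ i := by
  rw [← Equiv.Perm.mem_support, support_finRotate_of_le hm]
  exact mem_univ i

lemma exists_iterate_finRotate (hm : 2 ≤ m) (i j : Fin m) : ∃ k : ℕ, (finRotate m)^[k] i = j := by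
  obtain ⟨k, hk⟩ := (isCycle_finRotate_of_le hm).exists_pow_eq (finRotate_ne_self hm i)
    (finRotate_ne_self hm j)
  exact ⟨k, by rw [Equiv.Perm.iterate_eq_pow, hk]⟩

lemma finRotate_ne_symm (hm : 3 ≤ m) (i : Fin m) : finRotate m i ≠ (finRotate m).symm i := by
  rw [ne_eq, Equiv.eq_symm_apply, finRotate_eq_iff,
    ← (finRotate_eq_iff i (finRotate m i)).1 rfl]
  have hi := i.isLt
  rcases Nat.lt_or_ge (i.val + 1) m with h | h
  · rw [Nat.mod_eq_of_lt h]
    rcases Nat.lt_or_ge (i.val + 1 + 1) m with h' | h'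
    · rw [Nat.mod_eq_of_lt h']; omega
    · rw [show i.val + 1 + 1 = m by omega, Nat.mod_self]; omega
  · rw [show i.val + 1 = m by omega, Nat.mod_self, Nat.mod_eq_of_lt (by omega)]; omega

lemma cycleGraph_adj_iff (i j : Fin m) :
    (cycleGraph m).Adj i j ↔ i ≠ j ∧ (finRotate m i = j ∨ finRotate m j = i) := by
  simp only [cycleGraph, SimpleGraph.fromRel_adj, finRotate_eq_iff]

/-- The rim of the wheel as an induced cycle. -/
def cycleGraphEmbWheelGraph (m : ℕ) : cycleGraph m ↪g wheelGraph m where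
  toEmbedding := Function.Embedding.some
  map_rel_iff' := by simp [cycleGraph, wheelGraph]

lemma wheelGraph_adj_none (i : Fin m) : (wheelGraph m).Adj none (some i) := by
  simp [wheelGraph]

end Rotation

section Entropy

lemma graphEntropy_of_const {V : Type*} [Fintype V] [DecidableEq V] [Nonempty V]
    {G : SimpleGraph V} {s : ℝ} (hs : s ≠ 0) (h : ∀ v, shapley G v = s) :
    graphEntropy G = Real.log (Fintype.card V) := by
  have hi : ∀ v, influence G v = (Fintype.card V : ℝ)⁻¹ := by
    intro v
    simp only [influence, h, sum_const, card_univ, nsmul_eq_mul]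
    field_simp
  simp only [graphEntropy, hi, sum_const, card_univ, nsmul_eq_mul, Real.log_inv]
  field_simp

lemma graphEntropy_option {m : ℕ} {G : SimpleGraph (Option (Fin m))} {c r : ℝ} (hm : 0 < m)
    (hc : 0 < c) (hr : 0 < r) (hnone : shapley G none = c) (hsome : ∀ i, shapley G (some i) = r) :
    graphEntropy G = Real.qaryEntropy (m + 1) (m * r / (c + m * r)) := by
  have hm' : (0 : ℝ) < m := by exact_mod_cast hm
  have hT : 0 < c + m * r := by positivity
  simp only [graphEntropy, influence, Fintype.sum_option, hnone, hsome, sum_const, card_univ,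
    Fintype.card_fin, nsmul_eq_mul, Real.qaryEntropy, Real.binEntropy]
  have h1 : 1 - m * r / (c + m * r) = c / (c + m * r) := by field_simp; ring
  rw [h1, Real.log_inv, Real.log_inv, mul_div_assoc, Real.log_mul hm'.ne' (by positivity)]
  push_cast
  rw [add_sub_cancel_right]
  ring

lemma qaryEntropy_one_sub_inv {n : ℕ} (hn : 2 ≤ n) :
    Real.qaryEntropy n (1 - 1 / n) = Real.log n := by
  have hn' : (2 : ℝ) ≤ n := by exact_mod_cast hn
  have h1 : (n : ℝ) - 1 ≠ 0 := by linarith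
  have h2 : 1 - 1 / (n : ℝ) = (n - 1) / n := by field_simp
  have h3 : 1 - (n - 1) / (n : ℝ) = (n : ℝ)⁻¹ := by field_simp; ring
  rw [Real.qaryEntropy, Real.binEntropy, h2, h3, inv_inv, inv_div, Real.log_div (by positivity) h1]
  push_cast
  field_simp
  ring

end Entropy

/-- For every `n > 5`, the entropies of the complete graph `K_n`, the cycle
`C_n`, the wheel graph `W_n` and the star `S_{n−1}` satisfy
`H(K_n) = H(C_n) = log n > H(W_n) > H(S_{n−1})`. -/
theorem entropy_comparison (n : ℕ) (hn : 5 < n) :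
    graphEntropy (⊤ : SimpleGraph (Fin n)) = Real.log (n : ℝ) ∧
    graphEntropy (cycleGraph n) = Real.log (n : ℝ) ∧
    graphEntropy (wheelGraph (n - 1)) < Real.log (n : ℝ) ∧
    graphEntropy (starGraph (n - 1)) < graphEntropy (wheelGraph (n - 1)) := by
  have : Nonempty (Fin n) := ⟨⟨0, by omega⟩⟩
  have hnR : (6 : ℝ) ≤ n := by exact_mod_cast hn
  refine ⟨?_, ?_, ?_⟩
  · rw [graphEntropy_of_const (s := 1 / n) (by positivity) fun v => by simpa using shapley_top v,
      Fintype.card_fin]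
  · have hpos : (0 : ℝ) < 2 / 3 - 1 / n := by
      have : (1 / n : ℝ) ≤ 1 / 6 := by gcongr
      linarith
    rw [graphEntropy_of_const hpos.ne' fun v => by
      simpa using shapley_cycle (exists_iterate_finRotate (by omega)) cycleGraph_adj_iff
        (finRotate_ne_self (by omega)) (finRotate_ne_symm (by omega)) v, Fintype.card_fin]
  obtain ⟨m, rfl⟩ : ∃ m, n = m + 1 := ⟨n - 1, by omega⟩
  have : Nonempty (Fin m) := ⟨⟨0, by omega⟩⟩
  have hm : (5 : ℝ) ≤ m := by push_cast at hnR; linarith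
  rw [add_tsub_cancel_right]
  have hcW : shapley (wheelGraph m) none = (m : ℝ) / 6 - 1 + 3 / (m + 1) := by
    simpa using shapley_cone_cycle_none (exists_iterate_finRotate (by omega)) cycleGraph_adj_iff
      (finRotate_ne_self (by omega)) (cycleGraphEmbWheelGraph m) rfl wheelGraph_adj_none
  have hrW : ∀ i, shapley (wheelGraph m) (some i) = (1 : ℝ) / 3 - 1 / (m * (m + 1)) := fun i => by
    simpa using shapley_cone_cycle_some (exists_iterate_finRotate (by omega)) cycleGraph_adj_iff
      (finRotate_ne_self (by omega)) (finRotate_ne_symm (by omega)) (cycleGraphEmbWheelGraph m)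
      rfl wheelGraph_adj_none i
  have hcS := shapley_starGraph_none (m := m)
  have hr_pos : (0 : ℝ) < 1 / 3 - 1 / (m * (m + 1)) := by
    have : (1 : ℝ) / (m * (m + 1)) ≤ 1 / 30 := by gcongr; nlinarith
    linarith
  have hlt : (1 : ℝ) / 3 - 1 / (m * (m + 1)) < m / 6 - 1 + 3 / (m + 1) := by
    rw [← sub_pos]
    have : (m / 6 - 1 + 3 / (m + 1) - (1 / 3 - 1 / (m * (m + 1))) : ℝ) =
        (m * ((m - 5) * (m - 5) + 3 * (m - 5)) + 6) / (6 * m * (m + 1)) := by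
      field_simp
      ring
    rw [this]
    have : 0 ≤ (m : ℝ) - 5 := by linarith
    positivity
  have hcross : (m / 6 - 1 + 3 / (m + 1) : ℝ) * (1 / 2) <
      (m / 2 - 1 + 2 / (m + 1)) * (1 / 3 - 1 / (m * (m + 1))) := by
    rw [← sub_pos]
    have h : ((m / 2 - 1 + 2 / (m + 1)) * (1 / 3 - 1 / (m * (m + 1))) -
        (m / 6 - 1 + 3 / (m + 1)) * (1 / 2) : ℝ) =
        ((m - 5) ^ 4 + 24 * (m - 5) ^ 3 + 199 * (m - 5) ^ 2 + 688 * (m - 5) + 828) /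
          (12 * m * (m + 1) ^ 2) := by
      field_simp
      ring
    rw [h]
    have : 0 ≤ (m : ℝ) - 5 := by linarith
    positivity
  have hcW_pos := hr_pos.trans hlt
  have hcS_pos : (0 : ℝ) < m / 2 - 1 + 2 / (m + 1) := by
    have : (0 : ℝ) < 2 / (m + 1) := by positivity
    linarith
  generalize (m / 6 - 1 + 3 / (m + 1) : ℝ) = cW at *
  generalize (1 / 3 - 1 / (m * (m + 1)) : ℝ) = rW at *
  generalize (m / 2 - 1 + 2 / (m + 1) : ℝ) = cS at *
  rw [graphEntropy_option (by omega) hcW_pos hr_pos hcW hrW,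
    graphEntropy_option (by omega) hcS_pos (by norm_num) hcS shapley_starGraph_some,
    ← qaryEntropy_one_sub_inv (by omega)]
  have hmono := Real.qaryEntropy_strictMonoOn (q := m + 1) (by omega)
  have hmax : m * rW / (cW + m * rW) < 1 - 1 / ((m + 1 : ℕ) : ℝ) := by
    have : 1 - 1 / ((m + 1 : ℕ) : ℝ) = m / (m + 1) := by push_cast; field_simp; ring
    rw [this, div_lt_div_iff₀ (by positivity) (by positivity)]
    nlinarith
  have hSW : m * (1 / 2) / (cS + m * (1 / 2)) < m * rW / (cW + m * rW) := by
    rw [div_lt_div_iff₀ (by positivity) (by positivity)]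
    nlinarith
  exact ⟨hmono ⟨by positivity, hmax.le⟩ ⟨(by positivity : (0 : ℝ) ≤ _).trans hmax.le, le_rfl⟩ hmax,
    hmono ⟨by positivity, (hSW.trans hmax).le⟩ ⟨by positivity, hmax.le⟩ hSW⟩
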